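/- arXiv:2512.03595 — 7 statements merged into one kernel-verified Lean document; each statement's English description precedes it below -/
import Mathlib

section
/- Let σ > 0. If u ∈ ℝ⁴ has all four components nonnegative, satisfies F(u) = 0, and u₁ + u₂ + u₃ + u₄ = σ, then either u = σ·E_b or u = σ·E∘. In other words, σ·E_b and σ·E∘ are the only nonnegative zeros of the reaction map F whose components sum to σ. -/
/-- The reaction map of the reversible Gray–Scott model. -/
def grayScottF (k₁ k₂ k₃ k₄ : ℝ) (u : Fin 4 → ℝ) : Fin 4 → ℝ :=
  ![-(u 0) * (u 1) ^ 2 + k₂ * (u 1) ^ 3 - k₁ * u 0 + k₄ * u 3,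
    (u 0) * (u 1) ^ 2 - k₂ * (u 1) ^ 3 - u 1 + k₃ * u 2,
    u 1 - k₃ * u 2,
    k₁ * u 0 - k₄ * u 3]

/-- The interior equilibrium direction `E∘`. -/
noncomputable def grayScottEcirc (k₁ k₂ k₃ k₄ : ℝ) : Fin 4 → ℝ :=
  (1 / (k₁ * k₂ * k₃ + k₂ * k₃ * k₄ + k₃ * k₄ + k₄)) •
    ![k₂ * k₃ * k₄, k₃ * k₄, k₄, k₁ * k₂ * k₃]

/-- The boundary equilibrium direction `E_b`. -/
noncomputable def grayScottEb (k₁ k₄ : ℝ) : Fin 4 → ℝ :=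
  (1 / (k₁ + k₄)) • ![k₄, 0, 0, k₁]

theorem stmt1 (k₁ k₂ k₃ k₄ : ℝ) (hk₁ : 0 < k₁) (hk₂ : 0 < k₂) (hk₃ : 0 < k₃)
    (hk₄ : 0 < k₄) (σ : ℝ) (hσ : 0 < σ) (u : Fin 4 → ℝ) (hu : ∀ i, 0 ≤ u i)
    (hF : grayScottF k₁ k₂ k₃ k₄ u = 0)
    (hsum : u 0 + u 1 + u 2 + u 3 = σ) :
    u = σ • grayScottEb k₁ k₄ ∨ u = σ • grayScottEcirc k₁ k₂ k₃ k₄ := by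
  have hF₂ : u 0 * u 1 ^ 2 - k₂ * u 1 ^ 3 - u 1 + k₃ * u 2 = 0 := congrFun hF 1
  have hF₃ : u 1 - k₃ * u 2 = 0 := congrFun hF 2
  have hF₄ : k₁ * u 0 - k₄ * u 3 = 0 := congrFun hF 3
  have hfactor : u 1 ^ 2 * (u 0 - k₂ * u 1) = 0 := by linear_combination hF₂ + hF₃
  rcases mul_eq_zero.mp hfactor with h | h
  · left
    have h₁ : u 1 = 0 := pow_eq_zero_iff two_ne_zero |>.mp h
    have h₂ : u 2 = 0 := by
      have : k₃ * u 2 = 0 := by linear_combination h₁ - hF₃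
      exact (mul_eq_zero.mp this).resolve_left hk₃.ne'
    have hK : k₁ + k₄ ≠ 0 := by positivity
    ext i
    fin_cases i <;> simp [grayScottEb, h₁, h₂]
    · field_simp
      linear_combination k₄ * hsum + hF₄ - k₄ * h₁ - k₄ * h₂
    · field_simp
      linear_combination k₁ * hsum - hF₄ - k₁ * h₁ - k₁ * h₂
  · right
    have h₁ : u 1 = k₃ * u 2 := by linear_combination hF₃
    have h₀ : u 0 = k₂ * k₃ * u 2 := by linear_combination h + k₂ * h₁
    have h₃ : k₄ * u 3 = k₁ * k₂ * k₃ * u 2 := by linear_combination k₁ * h₀ - hF₄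
    have hK : 0 < k₁ * k₂ * k₃ + k₂ * k₃ * k₄ + k₃ * k₄ + k₄ := by positivity
    have hσK : u 2 * (k₁ * k₂ * k₃ + k₂ * k₃ * k₄ + k₃ * k₄ + k₄) = σ * k₄ := by
      linear_combination k₄ * hsum - k₄ * h₀ - k₄ * h₁ - h₃
    have hu₂ : u 2 = σ * k₄ / (k₁ * k₂ * k₃ + k₂ * k₃ * k₄ + k₃ * k₄ + k₄) :=
      (eq_div_iff hK.ne').mpr hσK
    have hu₃ : u 3 = k₁ * k₂ * k₃ * u 2 / k₄ := by
      rw [eq_div_iff hk₄.ne', mul_comm, h₃]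
    ext i
    fin_cases i <;> simp [grayScottEcirc, h₀, h₁, hu₃, hu₂] <;> field_simp
end

section
/- The weighted quadratic energy density e₂ satisfies e₂(E∘) = k₂k₃k₄/K₀ and e₂(E_b) = k₄/(k₁+k₄), and the strict inequality k₂k₃k₄/K₀ < k₄/(k₁+k₄) holds. Consequently, for every real c ≠ 0 one has e₂(c·E∘) < e₂(c·E_b); that is, the interior equilibrium has strictly smaller quadratic energy than the boundary equilibrium. -/
/-- The weighted quadratic energy density `e₂`. -/
noncomputable def grayScottE2 (k₁ k₂ k₃ k₄ : ℝ) (u : Fin 4 → ℝ) : ℝ :=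
  (u 0) ^ 2 + k₂ * (u 1) ^ 2 + k₂ * k₃ * (u 2) ^ 2 + (k₄ / k₁) * (u 3) ^ 2

theorem grayScottE2_smul (k₁ k₂ k₃ k₄ c : ℝ) (u : Fin 4 → ℝ) :
    grayScottE2 k₁ k₂ k₃ k₄ (c • u) = c ^ 2 * grayScottE2 k₁ k₂ k₃ k₄ u := by
  simp only [grayScottE2, Pi.smul_apply, smul_eq_mul]
  ring

theorem grayScottE2_grayScottEcirc {k₁ k₂ k₃ k₄ : ℝ} (hk₁ : 0 < k₁) (hk₂ : 0 < k₂)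
    (hk₃ : 0 < k₃) (hk₄ : 0 < k₄) :
    grayScottE2 k₁ k₂ k₃ k₄ (grayScottEcirc k₁ k₂ k₃ k₄) =
      k₂ * k₃ * k₄ / (k₁ * k₂ * k₃ + k₂ * k₃ * k₄ + k₃ * k₄ + k₄) := by
  have hK : k₁ * k₂ * k₃ + k₂ * k₃ * k₄ + k₃ * k₄ + k₄ ≠ 0 := by positivity
  rw [grayScottEcirc, grayScottE2_smul]
  simp only [grayScottE2, Matrix.cons_val]
  field_simp
  ring

theorem grayScottE2_grayScottEb (k₂ k₃ : ℝ) {k₁ k₄ : ℝ} (hk₁ : 0 < k₁) (hk₄ : 0 < k₄) :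
    grayScottE2 k₁ k₂ k₃ k₄ (grayScottEb k₁ k₄) = k₄ / (k₁ + k₄) := by
  have hK : k₁ + k₄ ≠ 0 := by positivity
  rw [grayScottEb, grayScottE2_smul]
  simp only [grayScottE2, Matrix.cons_val]
  field_simp
  ring

theorem interior_energy_lt_boundary_energy {k₁ k₂ k₃ k₄ : ℝ} (hk₁ : 0 < k₁) (hk₂ : 0 < k₂)
    (hk₃ : 0 < k₃) (hk₄ : 0 < k₄) :
    k₂ * k₃ * k₄ / (k₁ * k₂ * k₃ + k₂ * k₃ * k₄ + k₃ * k₄ + k₄) < k₄ / (k₁ + k₄) := by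
  rw [div_lt_div_iff₀ (by positivity) (by positivity)]
  have h : 0 < k₄ * (k₃ * k₄ + k₄) := by positivity
  linarith

theorem stmt2 (k₁ k₂ k₃ k₄ : ℝ) (hk₁ : 0 < k₁) (hk₂ : 0 < k₂) (hk₃ : 0 < k₃)
    (hk₄ : 0 < k₄) :
    grayScottE2 k₁ k₂ k₃ k₄ (grayScottEcirc k₁ k₂ k₃ k₄) =
      k₂ * k₃ * k₄ / (k₁ * k₂ * k₃ + k₂ * k₃ * k₄ + k₃ * k₄ + k₄) ∧
    grayScottE2 k₁ k₂ k₃ k₄ (grayScottEb k₁ k₄) = k₄ / (k₁ + k₄) ∧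
    k₂ * k₃ * k₄ / (k₁ * k₂ * k₃ + k₂ * k₃ * k₄ + k₃ * k₄ + k₄) < k₄ / (k₁ + k₄) ∧
    ∀ c : ℝ, c ≠ 0 →
      grayScottE2 k₁ k₂ k₃ k₄ (c • grayScottEcirc k₁ k₂ k₃ k₄) <
        grayScottE2 k₁ k₂ k₃ k₄ (c • grayScottEb k₁ k₄) := by
  have hcirc := grayScottE2_grayScottEcirc hk₁ hk₂ hk₃ hk₄
  have hb := grayScottE2_grayScottEb k₂ k₃ hk₁ hk₄
  have hlt := interior_energy_lt_boundary_energy hk₁ hk₂ hk₃ hk₄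
  refine ⟨hcirc, hb, hlt, fun c hc => ?_⟩
  rw [grayScottE2_smul, grayScottE2_smul, hcirc, hb]
  exact mul_lt_mul_of_pos_left hlt (by positivity)
end

section
/- For every function ψ : ℝ → ℝ and every u ∈ ℝ⁴, the following identity holds: ψ(u₁)·F₁(u) + ψ(k₂u₂)·F₂(u) + ψ(k₂k₃u₃)·F₃(u) + ψ(k₄u₄/k₁)·F₄(u) = −R_ψ(u), where R_ψ(u) := u₂²·(u₁ − k₂u₂)·(ψ(u₁) − ψ(k₂u₂)) + (u₂ − k₃u₃)·(ψ(k₂u₂) − ψ(k₂k₃u₃)) + k₁·(u₁ − k₄u₄/k₁)·(ψ(u₁) − ψ(k₄u₄/k₁)). Moreover, if ψ is monotone nondecreasing, then R_ψ(u) ≥ 0 for every u ∈ ℝ⁴. (Taking ψ = φ′ for a convex C² function φ, this is the reaction-part dissipation identity showing that 𝓔_φ is a Liapunov functional for the reversible Gray–Scott model.) -/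
/-- The reaction dissipation term `R_ψ`. -/
noncomputable def grayScottR (k₁ k₂ k₃ k₄ : ℝ) (ψ : ℝ → ℝ) (u : Fin 4 → ℝ) : ℝ :=
  (u 1) ^ 2 * (u 0 - k₂ * u 1) * (ψ (u 0) - ψ (k₂ * u 1)) +
  (u 1 - k₃ * u 2) * (ψ (k₂ * u 1) - ψ (k₂ * k₃ * u 2)) +
  k₁ * (u 0 - k₄ * u 3 / k₁) * (ψ (u 0) - ψ (k₄ * u 3 / k₁))

theorem Monotone.mul_sub_sub_nonneg {ψ : ℝ → ℝ} (hψ : Monotone ψ) (a b : ℝ) :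
    0 ≤ (a - b) * (ψ a - ψ b) := by
  rcases le_total a b with h | h
  · exact mul_nonneg_of_nonpos_of_nonpos (sub_nonpos.2 h) (sub_nonpos.2 (hψ h))
  · exact mul_nonneg (sub_nonneg.2 h) (sub_nonneg.2 (hψ h))

theorem stmt5 (k₁ k₂ k₃ k₄ : ℝ) (hk₁ : 0 < k₁) (hk₂ : 0 < k₂) (hk₃ : 0 < k₃)
    (hk₄ : 0 < k₄) (ψ : ℝ → ℝ) (u : Fin 4 → ℝ) :
    (ψ (u 0) * grayScottF k₁ k₂ k₃ k₄ u 0 +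
      ψ (k₂ * u 1) * grayScottF k₁ k₂ k₃ k₄ u 1 +
      ψ (k₂ * k₃ * u 2) * grayScottF k₁ k₂ k₃ k₄ u 2 +
      ψ (k₄ * u 3 / k₁) * grayScottF k₁ k₂ k₃ k₄ u 3 =
        -grayScottR k₁ k₂ k₃ k₄ ψ u) ∧
    (Monotone ψ → 0 ≤ grayScottR k₁ k₂ k₃ k₄ ψ u) := by
  constructor
  · have h : k₁ * (u 0 - k₄ * u 3 / k₁) = k₁ * u 0 - k₄ * u 3 := by
      field_simp
    simp only [grayScottF, grayScottR, h, Matrix.cons_val]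
    ring
  · intro hψ
    have h₁ := mul_nonneg (sq_nonneg (u 1)) (hψ.mul_sub_sub_nonneg (u 0) (k₂ * u 1))
    have h₂ : 0 ≤ (u 1 - k₃ * u 2) * (ψ (k₂ * u 1) - ψ (k₂ * k₃ * u 2)) := by
      refine nonneg_of_mul_nonneg_right ?_ hk₂
      linear_combination hψ.mul_sub_sub_nonneg (k₂ * u 1) (k₂ * k₃ * u 2)
    have h₃ := mul_nonneg hk₁.le (hψ.mul_sub_sub_nonneg (u 0) (k₄ * u 3 / k₁))
    rw [← mul_assoc] at h₁ h₃
    exact add_nonneg (add_nonneg h₁ h₂) h₃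
end

section
/- Fix e ≥ 0. If λ ∈ ℂ and v ∈ ℂ⁴ with v ≠ 0 satisfy L_e v = λ·v, then λ is real and λ ≤ 0. That is, every eigenvalue of the linearized reaction matrix L_e is a nonpositive real number. -/
/-- The reaction part `L_e` of the linearization of the reversible Gray–Scott system
at a spatially homogeneous equilibrium whose second component equals `e`. -/
def grayScottL (k₁ k₂ k₃ k₄ e : ℝ) (v : Fin 4 → ℂ) : Fin 4 → ℂ :=
  ![-(e : ℂ) ^ 2 * v 0 + (k₂ : ℂ) * (e : ℂ) ^ 2 * v 1 - (k₁ : ℂ) * v 0 + (k₄ : ℂ) * v 3,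
    (e : ℂ) ^ 2 * v 0 - (k₂ : ℂ) * (e : ℂ) ^ 2 * v 1 - v 1 + (k₃ : ℂ) * v 2,
    v 1 - (k₃ : ℂ) * v 2,
    (k₁ : ℂ) * v 0 - (k₄ : ℂ) * v 3]

open ComplexConjugate in
/-- The Hermitian form of `L_e` for the detailed-balance weights `k₁, k₁k₂, k₁k₂k₃, k₄`
is minus a sum of squared reaction fluxes. -/
theorem grayScottL_weighted_form (k₁ k₂ k₃ k₄ e : ℝ) (v : Fin 4 → ℂ) :
    k₁ * (conj (v 0) * grayScottL k₁ k₂ k₃ k₄ e v 0)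
      + k₁ * k₂ * (conj (v 1) * grayScottL k₁ k₂ k₃ k₄ e v 1)
      + k₁ * k₂ * k₃ * (conj (v 2) * grayScottL k₁ k₂ k₃ k₄ e v 2)
      + k₄ * (conj (v 3) * grayScottL k₁ k₂ k₃ k₄ e v 3)
    = -((k₁ * e ^ 2 * Complex.normSq (v 0 - k₂ * v 1)
      + k₁ * k₂ * Complex.normSq (v 1 - k₃ * v 2)
      + Complex.normSq (k₁ * v 0 - k₄ * v 3) : ℝ) : ℂ) := by
  push_cast
  simp only [← Complex.mul_conj, grayScottL, map_sub, map_mul, Complex.conj_ofReal]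
  simp
  ring

theorem stmt7 (k₁ k₂ k₃ k₄ : ℝ) (hk₁ : 0 < k₁) (hk₂ : 0 < k₂) (hk₃ : 0 < k₃)
    (hk₄ : 0 < k₄) (e : ℝ) (he : 0 ≤ e) (lam : ℂ) (v : Fin 4 → ℂ) (hv : v ≠ 0)
    (heig : grayScottL k₁ k₂ k₃ k₄ e v = lam • v) :
    lam.im = 0 ∧ lam.re ≤ 0 := by
  have hform := grayScottL_weighted_form k₁ k₂ k₃ k₄ e v
  rw [heig] at hform
  set D : ℝ := k₁ * e ^ 2 * Complex.normSq (v 0 - k₂ * v 1)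
    + k₁ * k₂ * Complex.normSq (v 1 - k₃ * v 2)
    + Complex.normSq (k₁ * v 0 - k₄ * v 3)
  have hD : 0 ≤ D := by
    have h (z : ℂ) := Complex.normSq_nonneg z
    have h₀ := h (v 0 - k₂ * v 1)
    have h₁ := h (v 1 - k₃ * v 2)
    have h₂ := h (k₁ * v 0 - k₄ * v 3)
    positivity
  set N : ℝ := k₁ * Complex.normSq (v 0) + k₁ * k₂ * Complex.normSq (v 1)
    + k₁ * k₂ * k₃ * Complex.normSq (v 2) + k₄ * Complex.normSq (v 3) with hN_def
  have hN : 0 < N := by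
    have h (i : Fin 4) := Complex.normSq_nonneg (v i)
    have h₀ := mul_nonneg hk₁.le (h 0)
    have h₁ := mul_nonneg (mul_pos hk₁ hk₂).le (h 1)
    have h₂ := mul_nonneg (mul_pos (mul_pos hk₁ hk₂) hk₃).le (h 2)
    have h₃ := mul_nonneg hk₄.le (h 3)
    obtain ⟨i, hi⟩ := Function.ne_iff.mp hv
    have hpos : 0 < Complex.normSq (v i) := Complex.normSq_pos.mpr hi
    fin_cases i
    · linarith [mul_pos hk₁ (show 0 < Complex.normSq (v 0) from hpos)]
    · linarith [mul_pos (mul_pos hk₁ hk₂) (show 0 < Complex.normSq (v 1) from hpos)]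
    · linarith [mul_pos (mul_pos (mul_pos hk₁ hk₂) hk₃) (show 0 < Complex.normSq (v 2) from hpos)]
    · linarith [mul_pos hk₄ (show 0 < Complex.normSq (v 3) from hpos)]
  have hlam : lam * (N : ℂ) = -(D : ℂ) := by
    rw [← hform, hN_def]
    push_cast
    simp only [← Complex.mul_conj, Pi.smul_apply, smul_eq_mul]
    ring
  have hre := congrArg Complex.re hlam
  have him := congrArg Complex.im hlam
  simp only [Complex.re_mul_ofReal, Complex.im_mul_ofReal, Complex.neg_re, Complex.neg_im,
    Complex.ofReal_re, Complex.ofReal_im, neg_zero] at hre him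
  refine ⟨(mul_eq_zero.mp him).resolve_right hN.ne', ?_⟩
  exact nonpos_of_mul_nonpos_left (by linarith) hN
end

section
/- Fix e > 0. If v ∈ ℂ⁴ satisfies L_e v = 0 and v₁ + v₂ + v₃ + v₄ = 0, then v = 0. Consequently, if λ ∈ ℂ is an eigenvalue of L_e admitting an eigenvector v ≠ 0 with v₁ + v₂ + v₃ + v₄ = 0, then λ is real and λ < 0. (This is the linear-algebra core of the fact that the interior equilibrium E_{∘,ϱ} is linearly stable on the mass-zero subspace.) -/
open Complex in
/-- Weighting the coordinates by detailed balance makes `L_e` symmetric and negative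
semidefinite: an eigenvalue is minus a dissipation divided by a weighted squared norm. -/
theorem grayScottL_eigenvalue_energy {k₁ k₂ k₃ k₄ e : ℝ} {lam : ℂ} {v : Fin 4 → ℂ}
    (h : grayScottL k₁ k₂ k₃ k₄ e v = lam • v) :
    lam * ((k₁ * normSq (v 0) + k₁ * k₂ * normSq (v 1) + k₁ * k₂ * k₃ * normSq (v 2)
        + k₄ * normSq (v 3) : ℝ) : ℂ) =
      ((-(normSq (k₁ * v 0 - k₄ * v 3) + k₁ * e ^ 2 * normSq (v 0 - k₂ * v 1)
        + k₁ * k₂ * normSq (v 1 - k₃ * v 2)) : ℝ) : ℂ) := by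
  have h0 := congrFun h 0
  have h1 := congrFun h 1
  have h2 := congrFun h 2
  have h3 := congrFun h 3
  simp only [grayScottL, Matrix.cons_val, Pi.smul_apply, smul_eq_mul] at h0 h1 h2 h3
  push_cast
  simp only [normSq_eq_conj_mul_self, map_sub, map_mul, conj_ofReal]
  linear_combination -(k₁ : ℂ) * (starRingEnd ℂ) (v 0) * h0
    - (k₁ : ℂ) * k₂ * (starRingEnd ℂ) (v 1) * h1
    - (k₁ : ℂ) * k₂ * k₃ * (starRingEnd ℂ) (v 2) * h2 - (k₄ : ℂ) * (starRingEnd ℂ) (v 3) * h3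

/-- Vanishing reaction fluxes and zero total mass force the vector to vanish. -/
theorem eq_zero_of_flux_eq_zero {k₁ k₂ k₃ k₄ : ℝ} (hk₁ : 0 < k₁) (hk₂ : 0 < k₂)
    (hk₃ : 0 < k₃) (hk₄ : 0 < k₄) {v : Fin 4 → ℂ} (hA : (k₁ : ℂ) * v 0 - k₄ * v 3 = 0)
    (hB : v 0 - k₂ * v 1 = 0) (hC : v 1 - k₃ * v 2 = 0)
    (hs : v 0 + v 1 + v 2 + v 3 = 0) : v = 0 := by
  have hne : ((k₄ * (k₂ * k₃ + k₃ + 1) + k₁ * k₂ * k₃ : ℝ) : ℂ) ≠ 0 := by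
    exact_mod_cast (by positivity : k₄ * (k₂ * k₃ + k₃ + 1) + k₁ * k₂ * k₃ ≠ 0)
  have hk₄' : (k₄ : ℂ) ≠ 0 := by exact_mod_cast hk₄.ne'
  have h2 : v 2 = 0 := by
    refine (mul_eq_zero.mp ?_).resolve_left hne
    push_cast
    linear_combination (k₄ : ℂ) * hs + hA - (k₄ + k₁ : ℂ) * hB
      - (k₄ + k₄ * k₂ + k₁ * k₂ : ℂ) * hC
  have h1 : v 1 = 0 := by linear_combination hC + (k₃ : ℂ) * h2
  have h0 : v 0 = 0 := by linear_combination hB + (k₂ : ℂ) * h1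
  have h3 : v 3 = 0 := by linear_combination hs - h0 - h1 - h2
  ext i
  fin_cases i <;> assumption

theorem stmt8 (k₁ k₂ k₃ k₄ : ℝ) (hk₁ : 0 < k₁) (hk₂ : 0 < k₂) (hk₃ : 0 < k₃)
    (hk₄ : 0 < k₄) (e : ℝ) (he : 0 < e) :
    (∀ v : Fin 4 → ℂ, grayScottL k₁ k₂ k₃ k₄ e v = 0 →
      v 0 + v 1 + v 2 + v 3 = 0 → v = 0) ∧
    (∀ (lam : ℂ) (v : Fin 4 → ℂ), v ≠ 0 → v 0 + v 1 + v 2 + v 3 = 0 →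
      grayScottL k₁ k₂ k₃ k₄ e v = lam • v → lam.im = 0 ∧ lam.re < 0) := by
  have ker (v : Fin 4 → ℂ) (h : grayScottL k₁ k₂ k₃ k₄ e v = 0)
      (hs : v 0 + v 1 + v 2 + v 3 = 0) : v = 0 := by
    have he' : (e : ℂ) ^ 2 ≠ 0 := by exact_mod_cast (by positivity : e ^ 2 ≠ 0)
    have h1 := congrFun h 1
    have h2 := congrFun h 2
    have h3 := congrFun h 3
    simp only [grayScottL, Matrix.cons_val, Pi.zero_apply] at h1 h2 h3
    refine eq_zero_of_flux_eq_zero hk₁ hk₂ hk₃ hk₄ h3 ((mul_eq_zero.mp ?_).resolve_left he') h2 hs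
    linear_combination h1 + h2
  refine ⟨ker, fun lam v hv hs h => ?_⟩
  have energy := grayScottL_eigenvalue_energy h
  set P := k₁ * Complex.normSq (v 0) + k₁ * k₂ * Complex.normSq (v 1)
    + k₁ * k₂ * k₃ * Complex.normSq (v 2) + k₄ * Complex.normSq (v 3)
  have n (z : ℂ) := Complex.normSq_nonneg z
  have hP_pos : 0 < P := by
    obtain ⟨i, hi⟩ := Function.ne_iff.mp hv
    have hi' := Complex.normSq_pos.mpr hi
    have p0 := mul_nonneg hk₁.le (n (v 0))
    have p1 := mul_nonneg (mul_pos hk₁ hk₂).le (n (v 1))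
    have p2 := mul_nonneg (mul_pos (mul_pos hk₁ hk₂) hk₃).le (n (v 2))
    have p3 := mul_nonneg hk₄.le (n (v 3))
    fin_cases i <;> dsimp at hi'
    · linarith [mul_pos hk₁ hi']
    · linarith [mul_pos (mul_pos hk₁ hk₂) hi']
    · linarith [mul_pos (mul_pos (mul_pos hk₁ hk₂) hk₃) hi']
    · linarith [mul_pos hk₄ hi']
  have him : lam.im = 0 := by
    have := congrArg Complex.im energy
    rw [Complex.im_mul_ofReal, Complex.ofReal_im] at this
    exact (mul_eq_zero.mp this).resolve_right hP_pos.ne'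
  have hre := congrArg Complex.re energy
  rw [Complex.re_mul_ofReal, Complex.ofReal_re] at hre
  have hle : lam.re ≤ 0 := by
    refine nonpos_of_mul_nonpos_left ?_ hP_pos
    rw [hre, neg_nonpos]
    have := n (k₁ * v 0 - k₄ * v 3)
    have := n (v 0 - k₂ * v 1)
    have := n (v 1 - k₃ * v 2)
    positivity
  refine ⟨him, hle.lt_of_ne fun h0 => hv (ker v ?_ hs)⟩
  rw [h, show lam = 0 from Complex.ext h0 him, zero_smul]
end

section
/- A vector v ∈ ℂ⁴ satisfies L₀ v = 0 and v₁ + v₂ + v₃ + v₄ = 0 if and only if v is a complex scalar multiple of the vector k := (k₄(1+k₃), −k₃(k₁+k₄), −(k₁+k₄), k₁(1+k₃)). In particular, the components of k sum to zero, L₀ k = 0, and the kernel of L₀ restricted to the zero-sum hyperplane {v : v₁+v₂+v₃+v₄ = 0} is the one-dimensional space ℂ·k. -/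
/-- The reaction part `L₀` of the linearization of the reversible Gray–Scott system
at the boundary equilibrium (whose second component vanishes), on ℂ⁴. -/
def grayScottL0 (k₁ k₃ k₄ : ℝ) (v : Fin 4 → ℂ) : Fin 4 → ℂ :=
  ![-(k₁ : ℂ) * v 0 + (k₄ : ℂ) * v 3,
    -v 1 + (k₃ : ℂ) * v 2,
    v 1 - (k₃ : ℂ) * v 2,
    (k₁ : ℂ) * v 0 - (k₄ : ℂ) * v 3]

/-- The kernel direction `k` of `L₀` on the zero-sum hyperplane, as a complex vector. -/
def grayScottKer (k₁ k₃ k₄ : ℝ) : Fin 4 → ℂ :=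
  ![((k₄ * (1 + k₃) : ℝ) : ℂ), ((-(k₃ * (k₁ + k₄)) : ℝ) : ℂ),
    ((-(k₁ + k₄) : ℝ) : ℂ), ((k₁ * (1 + k₃) : ℝ) : ℂ)]

theorem stmt9 (k₁ k₂ k₃ k₄ : ℝ) (hk₁ : 0 < k₁) (hk₂ : 0 < k₂) (hk₃ : 0 < k₃)
    (hk₄ : 0 < k₄) :
    (∀ v : Fin 4 → ℂ,
      (grayScottL0 k₁ k₃ k₄ v = 0 ∧ v 0 + v 1 + v 2 + v 3 = 0) ↔
        ∃ c : ℂ, v = c • grayScottKer k₁ k₃ k₄) ∧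
    grayScottKer k₁ k₃ k₄ 0 + grayScottKer k₁ k₃ k₄ 1 +
      grayScottKer k₁ k₃ k₄ 2 + grayScottKer k₁ k₃ k₄ 3 = 0 ∧
    grayScottL0 k₁ k₃ k₄ (grayScottKer k₁ k₃ k₄) = 0 := by
  have hs : (k₁ : ℂ) + k₄ ≠ 0 := by exact_mod_cast (add_pos hk₁ hk₄).ne'
  have hker : grayScottL0 k₁ k₃ k₄ (grayScottKer k₁ k₃ k₄) = 0 := by
    ext i
    fin_cases i <;> simp [grayScottL0, grayScottKer] <;> ring
  have hsum : grayScottKer k₁ k₃ k₄ 0 + grayScottKer k₁ k₃ k₄ 1 +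
      grayScottKer k₁ k₃ k₄ 2 + grayScottKer k₁ k₃ k₄ 3 = 0 := by
    simp [grayScottKer]
    ring
  refine ⟨fun v => ⟨?_, ?_⟩, hsum, hker⟩
  · rintro ⟨hL, hv⟩
    have h₂ : v 1 - (k₃ : ℂ) * v 2 = 0 := congrFun hL 2
    have h₃ : (k₁ : ℂ) * v 0 - (k₄ : ℂ) * v 3 = 0 := congrFun hL 3
    refine ⟨-v 2 / (k₁ + k₄), ?_⟩
    ext i
    fin_cases i <;> simp [grayScottKer] <;> field_simp
    · linear_combination h₃ + (k₄ : ℂ) * hv - (k₄ : ℂ) * h₂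
    · linear_combination h₂
    · ring
    · linear_combination -h₃ + (k₁ : ℂ) * hv - (k₁ : ℂ) * h₂
  · rintro ⟨c, rfl⟩
    constructor
    · ext i
      fin_cases i <;> simp [grayScottL0, grayScottKer] <;> ring
    · simp only [Pi.smul_apply, smul_eq_mul]
      linear_combination c * hsum
end

section
/- Let K > 0, δ₀ > 0 and s⁰ ∈ (0, δ₀). Suppose s : [0, ∞) → ℝ is differentiable, s(0) = s⁰, and that for every t ≥ 0 with 0 < s(t) < δ₀ the differential inequality −3K·s(t)² ≤ s′(t) ≤ −K·s(t)² holds. Then for every t ≥ 0 one has 0 < s⁰/(1 + 3K·s⁰·t) ≤ s(t) ≤ s⁰/(1 + K·s⁰·t) < δ₀. In particular, s(t) ∈ (0, δ₀) for all t ≥ 0 and s(t) → 0 as t → ∞. (This is the ODE comparison argument governing the dynamics on the one-dimensional center manifold at the boundary equilibrium.) -/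
/-- The explicit solution `a / (1 + c * a * t)` of the equation `y' = -c * y ^ 2`. -/
theorem hasDerivAt_div_one_add_mul {a c t : ℝ} (h : 1 + c * a * t ≠ 0) :
    HasDerivAt (fun t : ℝ => a / (1 + c * a * t)) (-c * (a / (1 + c * a * t)) ^ 2) t := by
  have hd : HasDerivAt (fun t : ℝ => 1 + c * a * t) (c * a) t := by
    simpa using ((hasDerivAt_id t).const_mul (c * a)).const_add 1
  refine ((hasDerivAt_const t a).div hd h).congr_deriv ?_
  rw [div_pow]
  ring

theorem le_div_one_add_mul_of_deriv_lt {a c : ℝ} (ha : 0 ≤ a) (hc : 0 ≤ c) {s s' : ℝ → ℝ}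
    (hs : ∀ t, 0 ≤ t → HasDerivAt s (s' t) t) (h0 : s 0 ≤ a)
    (hlt : ∀ t, 0 ≤ t → s t = a / (1 + c * a * t) → s' t < -c * s t ^ 2) {t : ℝ} (ht : 0 ≤ t) :
    s t ≤ a / (1 + c * a * t) := by
  have hB : ∀ x : ℝ, 0 ≤ x → HasDerivAt (fun t : ℝ => a / (1 + c * a * t))
      (-c * (a / (1 + c * a * x)) ^ 2) x := fun x hx =>
    hasDerivAt_div_one_add_mul (by positivity)
  refine image_le_of_deriv_right_lt_deriv_boundary' (a := 0) (b := t)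
    (fun x hx => (hs x hx.1).continuousAt.continuousWithinAt)
    (fun x hx => (hs x hx.1).hasDerivWithinAt) (by simpa using h0)
    (fun x hx => (hB x hx.1).continuousAt.continuousWithinAt)
    (fun x hx => (hB x hx.1).hasDerivWithinAt) (fun x hx hxB => ?_) ⟨ht, le_rfl⟩
  rw [← hxB]
  exact hlt x hx.1 hxB

theorem div_one_add_mul_le_of_lt_deriv {a c : ℝ} (ha : 0 ≤ a) (hc : 0 ≤ c) {s s' : ℝ → ℝ}
    (hs : ∀ t, 0 ≤ t → HasDerivAt s (s' t) t) (h0 : a ≤ s 0)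
    (hlt : ∀ t, 0 ≤ t → s t = a / (1 + c * a * t) → -c * s t ^ 2 < s' t) {t : ℝ} (ht : 0 ≤ t) :
    a / (1 + c * a * t) ≤ s t := by
  have hB : ∀ x : ℝ, 0 ≤ x → HasDerivAt (fun t : ℝ => a / (1 + c * a * t))
      (-c * (a / (1 + c * a * x)) ^ 2) x := fun x hx =>
    hasDerivAt_div_one_add_mul (by positivity)
  refine image_le_of_deriv_right_lt_deriv_boundary' (a := 0) (b := t)
    (fun x hx => (hB x hx.1).continuousAt.continuousWithinAt)
    (fun x hx => (hB x hx.1).hasDerivWithinAt) (by simpa using h0)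
    (fun x hx => (hs x hx.1).continuousAt.continuousWithinAt)
    (fun x hx => (hs x hx.1).hasDerivWithinAt) (fun x hx hxB => ?_) ⟨ht, le_rfl⟩
  rw [hxB]
  exact hlt x hx.1 hxB.symm

theorem tendsto_nhdsWithin_div_one_add_mul {a c t : ℝ} (S : Set ℝ) (h : 1 + c * a * t ≠ 0) :
    Filter.Tendsto (fun c : ℝ => a / (1 + c * a * t)) (nhdsWithin c S)
      (nhds (a / (1 + c * a * t))) :=
  have hc : ContinuousAt (fun c : ℝ => a / (1 + c * a * t)) c := by fun_prop (disch := exact h)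
  hc.continuousWithinAt.tendsto

theorem div_one_add_mul_mem_Ioo {a c t δ : ℝ} (ha : 0 < a) (haδ : a < δ) (hc : 0 ≤ c)
    (ht : 0 ≤ t) : a / (1 + c * a * t) ∈ Set.Ioo 0 δ := by
  refine ⟨by positivity, (div_le_self ha.le ?_).trans_lt haδ⟩
  have : 0 ≤ c * a * t := by positivity
  linarith


theorem stmt14 (K δ₀ s₀ : ℝ) (hK : 0 < K) (hδ₀ : 0 < δ₀) (hs₀ : 0 < s₀)
    (hs₀' : s₀ < δ₀) (s s' : ℝ → ℝ)
    (hderiv : ∀ t : ℝ, 0 ≤ t → HasDerivAt s (s' t) t)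
    (hinit : s 0 = s₀)
    (hineq : ∀ t : ℝ, 0 ≤ t → 0 < s t → s t < δ₀ →
      -3 * K * (s t) ^ 2 ≤ s' t ∧ s' t ≤ -K * (s t) ^ 2) :
    (∀ t : ℝ, 0 ≤ t →
      0 < s₀ / (1 + 3 * K * s₀ * t) ∧
      s₀ / (1 + 3 * K * s₀ * t) ≤ s t ∧
      s t ≤ s₀ / (1 + K * s₀ * t) ∧
      s₀ / (1 + K * s₀ * t) < δ₀) ∧
    Filter.Tendsto s Filter.atTop (nhds 0) := by
  have hupper : ∀ t : ℝ, 0 ≤ t → s t ≤ s₀ / (1 + K * s₀ * t) := by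
    intro t ht
    refine ge_of_tendsto
      (tendsto_nhdsWithin_div_one_add_mul (Set.Iio K) (by positivity)) ?_
    filter_upwards [Ioo_mem_nhdsLT hK] with c hc
    refine le_div_one_add_mul_of_deriv_lt hs₀.le hc.1.le hderiv hinit.le (fun x hx hxB => ?_) ht
    obtain ⟨hpos, hlt⟩ : s x ∈ Set.Ioo 0 δ₀ :=
      hxB ▸ div_one_add_mul_mem_Ioo hs₀ hs₀' hc.1.le hx
    refine (hineq x hx hpos hlt).2.trans_lt ?_
    have := hc.2
    gcongr
  have hlower : ∀ t : ℝ, 0 ≤ t → s₀ / (1 + 3 * K * s₀ * t) ≤ s t := by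
    intro t ht
    refine le_of_tendsto
      (tendsto_nhdsWithin_div_one_add_mul (Set.Ioi (3 * K)) (by positivity)) ?_
    filter_upwards [self_mem_nhdsWithin] with c (hc : 3 * K < c)
    have hc0 : 0 ≤ c := by linarith
    refine div_one_add_mul_le_of_lt_deriv hs₀.le hc0 hderiv hinit.ge (fun x hx hxB => ?_) ht
    obtain ⟨hpos, hlt⟩ : s x ∈ Set.Ioo 0 δ₀ :=
      hxB ▸ div_one_add_mul_mem_Ioo hs₀ hs₀' hc0 hx
    refine lt_of_lt_of_le ?_ (hineq x hx hpos hlt).1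
    rw [neg_mul 3 K]
    gcongr
  have hK3 : 0 ≤ 3 * K := by positivity
  refine ⟨fun t ht => ⟨(div_one_add_mul_mem_Ioo hs₀ hs₀' hK3 ht).1, hlower t ht, hupper t ht,
    (div_one_add_mul_mem_Ioo hs₀ hs₀' hK.le ht).2⟩, ?_⟩
  have hlim : Filter.Tendsto (fun t : ℝ => s₀ / (1 + K * s₀ * t)) Filter.atTop (nhds 0) :=
    Filter.Tendsto.const_div_atTop (Filter.tendsto_atTop_add_const_left _ _
      (Filter.tendsto_id.const_mul_atTop (by positivity))) _
  refine squeeze_zero' ?_ ?_ hlim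
  · filter_upwards [Filter.eventually_ge_atTop 0] with t ht
    exact (div_one_add_mul_mem_Ioo hs₀ hs₀' hK3 ht).1.le.trans (hlower t ht)
  · filter_upwards [Filter.eventually_ge_atTop 0] with t ht using hupper t ht
end
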